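/- (Corollary 1, achievability of the successive Wyner-Ziv Routing scheme) Let (U_1,…,U_L) be random variables taking values in finite alphabets 𝒰_1,…,𝒰_L, jointly distributed with the sources according to a pmf of the form p(s_1,…,s_L)·∏_{l=1}^L p(u_l | s_l), and let g: 𝒰_1×…×𝒰_L → 𝒵̂ be a function such that E[d(φ(S_1,…,S_L), g(U_1,…,U_L))] ≤ D. If the rate tuple (R_1,…,R_L) satisfies R_l ≥ Σ_{i=1}^{l} I(S_i; U_i | U_1,…,U_{i-1}) for every l = 1,…,L, then (R_1,…,R_L) achieves distortion D. -/

import Mathlib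

namespace Cascade

structure FinPMF (Ω : Type) [Fintype Ω] where
  p : Ω → ℝ
  nonneg : ∀ ω, 0 ≤ p ω
  sum_one : ∑ ω, p ω = 1

variable {Ω : Type} [Fintype Ω]

/-- Probability that the random variable `X` takes the value `x`. -/
noncomputable def prob (μ : FinPMF Ω) {α : Type} [DecidableEq α] (X : Ω → α) (x : α) : ℝ :=
  ∑ ω ∈ Finset.univ.filter (fun ω => X ω = x), μ.p ω

/-- Expectation of a real random variable. -/
noncomputable def expect (μ : FinPMF Ω) (f : Ω → ℝ) : ℝ := ∑ ω, μ.p ω * f ω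

/-- Shannon entropy (base 2) of a finite-valued random variable. -/
noncomputable def entropy (μ : FinPMF Ω) {α : Type} [Fintype α] [DecidableEq α] (X : Ω → α) : ℝ :=
  -∑ x, prob μ X x * Real.logb 2 (prob μ X x)

/-- Conditional mutual information `I(X;Y|Z)` (base 2). -/
noncomputable def condMI (μ : FinPMF Ω) {α β γ : Type} [Fintype α] [DecidableEq α]
    [Fintype β] [DecidableEq β] [Fintype γ] [DecidableEq γ]
    (X : Ω → α) (Y : Ω → β) (Z : Ω → γ) : ℝ :=
  entropy μ (fun ω => (X ω, Z ω)) + entropy μ (fun ω => (Y ω, Z ω))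
    - entropy μ (fun ω => (X ω, Y ω, Z ω)) - entropy μ Z

/-- A cascade code: terminal `l` encodes its observed block together with the message
received from terminal `l-1` (messages are natural numbers; the message of terminal `l`
lies in `Fin (M l)`, and the initial message `m_0` is the constant `0`). -/
structure Code (L n : ℕ) (S : Fin L → Type) (Zhat : Type) where
  M : Fin L → ℕ
  M_pos : ∀ l, 0 < M l
  enc : (l : Fin L) → (Fin n → S l) → ℕ → Fin (M l)
  dec : ℕ → Fin n → Zhat

/-- `msg c s k` is the message `m_k` produced by terminal `k` (with `m_0 = 0`). -/
def msg {L n : ℕ} {S : Fin L → Type} {Zhat : Type} (c : Code L n S Zhat)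
    (s : ∀ l, Fin n → S l) : ℕ → ℕ
  | 0 => 0
  | k + 1 => if h : k < L then (c.enc ⟨k, h⟩ (s ⟨k, h⟩) (msg c s k) : ℕ) else msg c s k

/-- The i.i.d. pmf of `n` copies of the source tuple. -/
noncomputable def iidPMF {L : ℕ} {S : Fin L → Type} [∀ l, Fintype (S l)] (n : ℕ)
    (pS : (∀ l, S l) → ℝ) (h0 : ∀ s, 0 ≤ pS s) (h1 : ∑ s, pS s = 1) :
    FinPMF (Fin n → ∀ l, S l) where
  p ω := ∏ i, pS (ω i)
  nonneg ω := Finset.prod_nonneg fun i _ => h0 (ω i)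
  sum_one := by
    classical
    rw [← Fintype.piFinset_univ, ← Finset.prod_univ_sum (fun _ => Finset.univ) (fun _ s => pS s)]
    simp [h1]

/-- The reconstruction `Ẑ^n` produced by the code on source realization `ω`. -/
def reconstruct {L n : ℕ} {S : Fin L → Type} {Zhat : Type} (c : Code L n S Zhat)
    (ω : Fin n → ∀ l, S l) : Fin n → Zhat :=
  c.dec (msg c (fun l i => ω i l) L)

/-- Average per-letter distortion of the code on source realization `ω`. -/
noncomputable def avgDistortion {L n : ℕ} {S : Fin L → Type} {Zt Zhat : Type}
    (φ : (∀ l, S l) → Zt) (d : Zt → Zhat → ℝ) (c : Code L n S Zhat)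
    (ω : Fin n → ∀ l, S l) : ℝ :=
  (n : ℝ)⁻¹ * ∑ i, d (φ (ω i)) (reconstruct c ω i)

/-- The rate tuple `R` achieves distortion `D` for the cascade source coding problem. -/
def AchievesDistortion {L : ℕ} {S : Fin L → Type} [∀ l, Fintype (S l)]
    (pS : (∀ l, S l) → ℝ) (h0 : ∀ s, 0 ≤ pS s) (h1 : ∑ s, pS s = 1)
    {Zt Zhat : Type} (φ : (∀ l, S l) → Zt) (d : Zt → Zhat → ℝ)
    (R : Fin L → ℝ) (D : ℝ) : Prop :=
  ∀ ε : ℝ, 0 < ε → ∃ n : ℕ, 0 < n ∧ ∃ c : Code L n S Zhat,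
    (∀ l, Real.logb 2 (c.M l) / n ≤ R l + ε) ∧
    expect (iidPMF n pS h0 h1) (avgDistortion φ d c) ≤ D + ε

end Cascade

namespace Cascade

set_option linter.unusedSectionVars false

/-! ### One-shot channel simulation by greedy rejection sampling -/

/-- Output law of rejection sampling with `k` proposals. -/
noncomputable def lam {β : Type} [Fintype β] [DecidableEq β] (p q : β → ℝ) (T : ℝ) (u0 : β) :
    ℕ → β → ℝ
  | 0, u => if u = u0 then 1 else 0
  | k + 1, u => min (p u) (q u / T) + (1 - ∑ b, min (p b) (q b / T)) * lam p q T u0 k u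

section OneShot
variable {β : Type} [Fintype β] [DecidableEq β]

lemma lam_mass (p q : β → ℝ) (hp1 : ∑ b, p b = 1) (T : ℝ) :
    0 ≤ 1 - ∑ b, min (p b) (q b / T) := by
  have : ∑ b, min (p b) (q b / T) ≤ ∑ b, p b := Finset.sum_le_sum fun b _ => min_le_left _ _
  linarith

lemma lam_nonneg (p q : β → ℝ) (hp0 : ∀ b, 0 ≤ p b) (hp1 : ∑ b, p b = 1) (hq0 : ∀ b, 0 ≤ q b)
    (T : ℝ) (hT : 1 ≤ T) (u0 : β) (k : ℕ) (u : β) : 0 ≤ lam p q T u0 k u := by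
  induction k with
  | zero => simp only [lam]; split_ifs <;> norm_num
  | succ k ih =>
    simp only [lam]
    have h1 : 0 ≤ min (p u) (q u / T) := le_min (hp0 u) (div_nonneg (hq0 u) (by linarith))
    have h2 := lam_mass p q hp1 T
    positivity

lemma lam_sum (p q : β → ℝ) (T : ℝ) (u0 : β) (k : ℕ) : ∑ u, lam p q T u0 k u = 1 := by
  induction k with
  | zero => simp [lam]
  | succ k ih =>
    simp only [lam]
    rw [Finset.sum_add_distrib, ← Finset.mul_sum, ih]
    ring

lemma lam_lower (p q : β → ℝ) (hp0 : ∀ b, 0 ≤ p b) (hp1 : ∑ b, p b = 1) (hq0 : ∀ b, 0 ≤ q b)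
    (hq1 : ∑ b, q b = 1)
    (T : ℝ) (hT : 1 ≤ T) (u0 : β) (k : ℕ) (u : β) :
    (1 - (1 - 1 / T) ^ k) * (T * min (p u) (q u / T)) ≤ lam p q T u0 k u := by
  have hT0 : 0 < T := by linarith
  induction k with
  | zero =>
    have := lam_nonneg p q hp0 hp1 hq0 T hT u0 0 u
    simpa using this
  | succ k ih =>
    simp only [lam]
    have h1 : 0 ≤ min (p u) (q u / T) := le_min (hp0 u) (div_nonneg (hq0 u) (by linarith))
    have h2 : 1 - 1 / T ≤ 1 - ∑ b, min (p b) (q b / T) := by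
      have : ∑ b, min (p b) (q b / T) ≤ ∑ b, q b / T :=
        Finset.sum_le_sum fun b _ => min_le_right _ _
      rw [← Finset.sum_div, hq1] at this
      linarith
    have h3 : 0 ≤ 1 - 1 / T := by
      rw [sub_nonneg, div_le_one hT0]; exact hT
    have h4 := lam_nonneg p q hp0 hp1 hq0 T hT u0 k u
    calc (1 - (1 - 1 / T) ^ (k + 1)) * (T * min (p u) (q u / T))
        = min (p u) (q u / T) + (1 - 1 / T) * ((1 - (1 - 1 / T) ^ k) * (T * min (p u) (q u / T))) := by
          have e : T * (1 / T) = 1 := mul_one_div_cancel hT0.ne'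
          generalize min (p u) (q u / T) = m at *
          generalize 1 / T = x at *
          linear_combination m * e
      _ ≤ min (p u) (q u / T) + (1 - 1 / T) * lam p q T u0 k u := by gcongr
      _ ≤ _ := by gcongr

/-- A value at most the average exists. -/
lemma exists_le_avg (p : β → ℝ) (hp0 : ∀ b, 0 ≤ p b) (hp1 : ∑ b, p b = 1) (F : β → ℝ) :
    ∃ b, F b ≤ ∑ b, p b * F b := by
  by_contra! h
  set c := ∑ b, p b * F b with hc
  have h1 : ∑ b, p b * c < ∑ b, p b * F b := by
    apply Finset.sum_lt_sum
    · intro b _; exact mul_le_mul_of_nonneg_left (h b).le (hp0 b)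
    · by_contra! h2
      have : ∀ b, p b = 0 := by
        intro b
        have h3 := h2 b (Finset.mem_univ b)
        have h4 := h b
        have h5 := hp0 b
        by_contra h6
        have : 0 < p b := lt_of_le_of_ne h5 (Ne.symm h6)
        nlinarith
      simp [this] at hp1
  rw [← Finset.sum_mul, hp1, one_mul] at h1
  exact lt_irrefl _ h1

lemma oneShot {α : Type} [Fintype α] (p : β → ℝ) (q : α → β → ℝ) (hp0 : ∀ b, 0 ≤ p b)
    (hp1 : ∑ b, p b = 1) (hq0 : ∀ a b, 0 ≤ q a b) (T : ℝ) (hT : 1 ≤ T) (u0 : β) (k : ℕ) :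
    ∀ W : α → β → ℝ, ∃ f : α → β, (Finset.univ.image f).card ≤ k + 1 ∧
      ∑ a, W a (f a) ≤ ∑ a, ∑ b, lam p (q a) T u0 k b * W a b := by
  have hT0 : 0 < T := by linarith
  induction k with
  | zero =>
    intro W
    refine ⟨fun _ => u0, ?_, ?_⟩
    · refine (Finset.card_le_card (t := {u0}) ?_).trans (by simp)
      intro x hx
      simp only [Finset.mem_image] at hx
      obtain ⟨_, _, h⟩ := hx
      simp [h]
    · simp [lam]
  | succ k ih =>
    intro W
    let m : α → β → ℝ := fun a b => min (p b) (q a b / T)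
    let acc : α → β → ℝ := fun a b => m a b / p b
    have hm0 : ∀ a b, 0 ≤ m a b := fun a b => le_min (hp0 b) (div_nonneg (hq0 a b) hT0.le)
    have hmp : ∀ a b, m a b ≤ p b := fun a b => min_le_left _ _
    have hacc0 : ∀ a b, 0 ≤ acc a b := fun a b => div_nonneg (hm0 a b) (hp0 b)
    have hacc1 : ∀ a b, acc a b ≤ 1 := fun a b => div_le_one_of_le₀ (hmp a b) (hp0 b)
    have hpacc : ∀ a b, p b * acc a b = m a b := by
      intro a b
      by_cases h : p b = 0
      · have := hm0 a b; have := hmp a b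
        simp only [h, zero_mul]; linarith
      · simp only [acc]; field_simp
    let Lk : α → ℝ := fun a => ∑ b, lam p (q a) T u0 k b * W a b
    obtain ⟨u1, hu1⟩ := exists_le_avg p hp0 hp1
      (fun u => ∑ a, (acc a u * W a u + (1 - acc a u) * Lk a))
    obtain ⟨f', hf', hf'W⟩ := ih (fun a b => (1 - acc a u1) * W a b)
    refine ⟨fun a => if W a u1 ≤ W a (f' a) then u1 else f' a, ?_, ?_⟩
    · refine (Finset.card_le_card (t := insert u1 (Finset.univ.image f')) ?_).trans
        ((Finset.card_insert_le _ _).trans (by omega))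
      intro x hx
      simp only [Finset.mem_image, Finset.mem_univ, true_and] at hx
      obtain ⟨a, h⟩ := hx
      simp only [Finset.mem_insert, Finset.mem_image, Finset.mem_univ, true_and]
      split_ifs at h with h'
      · exact Or.inl h.symm
      · exact Or.inr ⟨a, h⟩
    · have e1 : ∑ a, W a (if W a u1 ≤ W a (f' a) then u1 else f' a) ≤
          ∑ a, (acc a u1 * W a u1 + (1 - acc a u1) * W a (f' a)) := by
        apply Finset.sum_le_sum
        intro a _
        have h0 := hacc0 a u1
        have h1 := hacc1 a u1
        split_ifs with h
        · nlinarith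
        · nlinarith
      have e2 : ∑ a, (acc a u1 * W a u1 + (1 - acc a u1) * W a (f' a)) ≤
          ∑ a, (acc a u1 * W a u1 + (1 - acc a u1) * Lk a) := by
        rw [Finset.sum_add_distrib, Finset.sum_add_distrib]
        refine add_le_add le_rfl (hf'W.trans (le_of_eq ?_))
        apply Finset.sum_congr rfl
        intro a _
        simp only [Lk, Finset.mul_sum]
        apply Finset.sum_congr rfl
        intro b _
        ring
      have e3 : ∑ u, p u * ∑ a, (acc a u * W a u + (1 - acc a u) * Lk a) =
          ∑ a, ∑ b, lam p (q a) T u0 (k + 1) b * W a b := by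
        simp only [Finset.mul_sum]
        rw [Finset.sum_comm]
        apply Finset.sum_congr rfl
        intro a _
        have : ∀ u, p u * (acc a u * W a u + (1 - acc a u) * Lk a) =
            m a u * W a u + (p u - m a u) * Lk a := by
          intro u; rw [← hpacc a u]; ring
        simp only [this, lam]
        rw [Finset.sum_add_distrib, ← Finset.sum_mul, Finset.sum_sub_distrib, hp1]
        simp only [add_mul, Finset.sum_add_distrib]
        congr 1
        simp only [Lk, Finset.mul_sum, m]
        apply Finset.sum_congr rfl
        intro b _
        ring
      exact e1.trans (e2.trans (hu1.trans e3.le))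

end OneShot

/-! ### Sequential randomized evaluation -/

section Seq
variable {L : ℕ} {A B : Fin L → Type} [∀ l, Fintype (A l)] [∀ l, DecidableEq (A l)]
  [∀ l, Fintype (B l)] [∀ l, DecidableEq (B l)]

/-- Sequential evaluation of the first `k` kernels. -/
noncomputable def Ew (w : ∀ i, A i → (∀ j, B j) → B i → ℝ) (b0 : ∀ j, B j) (s : ∀ l, A l) :
    ℕ → ((∀ l, B l) → ℝ) → ℝ
  | 0, D => D b0
  | k + 1, D => Ew w b0 s k (fun u => if h : k < L then
      ∑ b, w ⟨k, h⟩ (s ⟨k, h⟩) u b * D (Function.update u ⟨k, h⟩ b) else D u)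

lemma Ew_mono_D (w : ∀ i, A i → (∀ j, B j) → B i → ℝ) (hw : ∀ i a u b, 0 ≤ w i a u b)
    (b0 : ∀ j, B j) (s : ∀ l, A l) (k : ℕ) :
    ∀ D D' : (∀ l, B l) → ℝ, (∀ u, D u ≤ D' u) → Ew w b0 s k D ≤ Ew w b0 s k D' := by
  induction k with
  | zero => intro D D' h; exact h _
  | succ k ih =>
    intro D D' h
    simp only [Ew]
    apply ih
    intro u
    split_ifs
    · exact Finset.sum_le_sum fun b _ => mul_le_mul_of_nonneg_left (h _) (hw _ _ _ _)
    · exact h u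

lemma Ew_mono_w (w w' : ∀ i, A i → (∀ j, B j) → B i → ℝ) (hw : ∀ i a u b, 0 ≤ w i a u b)
    (hww : ∀ i a u b, w i a u b ≤ w' i a u b)
    (b0 : ∀ j, B j) (s : ∀ l, A l) (k : ℕ) :
    ∀ D : (∀ l, B l) → ℝ, (∀ u, 0 ≤ D u) → Ew w b0 s k D ≤ Ew w' b0 s k D := by
  induction k with
  | zero => intro D h; exact le_rfl
  | succ k ih =>
    intro D h
    simp only [Ew]
    refine (Ew_mono_D w hw b0 s k _ _ ?_).trans (ih _ ?_)
    · intro u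
      split_ifs
      · exact Finset.sum_le_sum fun b _ => mul_le_mul_of_nonneg_right (hww _ _ _ _) (h _)
      · exact le_rfl
    · intro u
      split_ifs
      · exact Finset.sum_nonneg fun b _ => mul_nonneg ((hw _ _ _ _).trans (hww _ _ _ _)) (h _)
      · exact h u

lemma Ew_const_sub (w : ∀ i, A i → (∀ j, B j) → B i → ℝ)
    (hw1 : ∀ i a u, ∑ b, w i a u b = 1) (b0 : ∀ j, B j) (s : ∀ l, A l) (c : ℝ) (k : ℕ) :
    ∀ D : (∀ l, B l) → ℝ, Ew w b0 s k (fun u => c - D u) = c - Ew w b0 s k D := by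
  induction k with
  | zero => intro D; rfl
  | succ k ih =>
    intro D
    simp only [Ew]
    rw [← ih]
    congr 1
    funext u
    split_ifs
    · simp only [mul_sub, Finset.sum_sub_distrib, ← Finset.sum_mul, hw1, one_mul]
    · rfl

lemma Ew_const (w : ∀ i, A i → (∀ j, B j) → B i → ℝ)
    (hw1 : ∀ i a u, ∑ b, w i a u b = 1) (b0 : ∀ j, B j) (s : ∀ l, A l) (c : ℝ) (k : ℕ) :
    Ew w b0 s k (fun _ => c) = c := by
  induction k with
  | zero => rfl
  | succ k ih =>
    simp only [Ew, ← Finset.sum_mul, hw1, one_mul, dite_eq_ite, ite_self]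
    exact ih

lemma Ew_unroll_aux (w : ∀ i, A i → (∀ j, B j) → B i → ℝ)
    (hloc : ∀ i a u u' b, (∀ j, j < i → u j = u' j) → w i a u b = w i a u' b)
    (b0 : ∀ j, B j) (s : ∀ l, A l) (k : ℕ) (hk : k ≤ L) :
    ∀ D : (∀ l, B l) → ℝ, Ew w b0 s k D =
      ∑ u ∈ Finset.univ.filter (fun u : ∀ l, B l => ∀ j : Fin L, k ≤ j.val → u j = b0 j),
        (∏ i ∈ Finset.univ.filter (fun i : Fin L => i.val < k), w i (s i) u (u i)) * D u := by
  induction k with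
  | zero =>
    intro D
    have : (Finset.univ.filter (fun u : ∀ l, B l => ∀ j : Fin L, 0 ≤ j.val → u j = b0 j)) = {b0} := by
      ext u
      simp [funext_iff]
    rw [this]
    simp [Ew]
  | succ k ih =>
    intro D
    have hkL : k < L := hk
    simp only [Ew, hkL, dif_pos]
    rw [ih hkL.le]
    simp only [Finset.mul_sum]
    rw [← Finset.sum_product']
    refine Finset.sum_nbij' (fun x => Function.update x.1 ⟨k, hkL⟩ x.2)
      (fun u => (Function.update u ⟨k, hkL⟩ (b0 _), u ⟨k, hkL⟩)) ?_ ?_ ?_ ?_ ?_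
    · rintro ⟨u, b⟩ h
      simp only [Finset.mem_product, Finset.mem_filter, Finset.mem_univ, true_and, and_true] at h ⊢
      intro j hj
      rw [Function.update_of_ne (by intro h; subst h; simp at hj)]
      exact h j (by omega)
    · intro u h
      simp only [Finset.mem_product, Finset.mem_filter, Finset.mem_univ, true_and, and_true] at h ⊢
      intro j hj
      by_cases hjk : j = ⟨k, hkL⟩
      · subst hjk; simp
      · rw [Function.update_of_ne hjk]
        apply h
        have : j.val ≠ k := fun h => hjk (Fin.ext h)
        omega
    · rintro ⟨u, b⟩ h
      simp only [Finset.mem_product, Finset.mem_filter, Finset.mem_univ, true_and, and_true] at h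
      simp only [Function.update_idem, Function.update_self, Prod.mk.injEq, and_true]
      rw [← h ⟨k, hkL⟩ le_rfl, Function.update_eq_self]
    · intro u h
      simp
    · rintro ⟨u, b⟩ h
      have hset : (Finset.univ.filter (fun i : Fin L => i.val < k + 1)) =
          insert ⟨k, hkL⟩ (Finset.univ.filter (fun i : Fin L => i.val < k)) := by
        ext i
        simp only [Finset.mem_filter, Finset.mem_univ, true_and, Finset.mem_insert, Fin.ext_iff]
        omega
      rw [hset, Finset.prod_insert (by simp)]
      have hne : ∀ j : Fin L, j.val < k → Function.update u ⟨k, hkL⟩ b j = u j := by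
        intro j hj
        rw [Function.update_of_ne (by intro h; subst h; simp at hj)]
      have h1 : ∀ i ∈ Finset.univ.filter (fun i : Fin L => i.val < k),
          w i (s i) (Function.update u ⟨k, hkL⟩ b) (Function.update u ⟨k, hkL⟩ b i) =
          w i (s i) u (u i) := by
        intro i hi
        simp only [Finset.mem_filter, Finset.mem_univ, true_and] at hi
        rw [hne i hi]
        apply hloc
        intro j hj
        exact hne j (lt_trans hj hi)
      rw [Finset.prod_congr rfl h1]
      have h2 : w ⟨k, hkL⟩ (s ⟨k, hkL⟩) (Function.update u ⟨k, hkL⟩ b)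
          (Function.update u ⟨k, hkL⟩ b ⟨k, hkL⟩) = w ⟨k, hkL⟩ (s ⟨k, hkL⟩) u b := by
        rw [Function.update_self]
        apply hloc
        intro j hj
        exact hne j hj
      rw [h2]
      ring

lemma Ew_unroll (w : ∀ i, A i → (∀ j, B j) → B i → ℝ)
    (hloc : ∀ i a u u' b, (∀ j, j < i → u j = u' j) → w i a u b = w i a u' b)
    (b0 : ∀ j, B j) (s : ∀ l, A l) (D : (∀ l, B l) → ℝ) : Ew w b0 s L D =
      ∑ u, (∏ i, w i (s i) u (u i)) * D u := by
  rw [Ew_unroll_aux w hloc b0 s L le_rfl D]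
  have h1 : (Finset.univ.filter (fun u : ∀ l, B l => ∀ j : Fin L, L ≤ j.val → u j = b0 j)) =
      Finset.univ := by
    ext u
    simp only [Finset.mem_filter, Finset.mem_univ, true_and, iff_true]
    intro j hj
    exact absurd j.isLt (by omega)
  rw [h1]
  simp

/-- Deterministic state after `k` stages. -/
def stt (f : ∀ i, A i → (∀ j, B j) → B i) (b0 : ∀ j, B j) (s : ∀ l, A l) : ℕ → ∀ j, B j
  | 0 => b0
  | k + 1 => if h : k < L then
      Function.update (stt f b0 s k) ⟨k, h⟩ (f ⟨k, h⟩ (s ⟨k, h⟩) (stt f b0 s k))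
    else stt f b0 s k

lemma stt_congr (f f' : ∀ i, A i → (∀ j, B j) → B i) (b0 : ∀ j, B j) (s : ∀ l, A l) (k : ℕ)
    (h : ∀ i : Fin L, i.val < k → f i = f' i) : stt f b0 s k = stt f' b0 s k := by
  induction k with
  | zero => rfl
  | succ k ih =>
    simp only [stt]
    rw [ih fun i hi => h i (by omega)]
    split_ifs with hk
    · rw [h ⟨k, hk⟩ (by simp)]
    · rfl

theorem derand (P : (∀ l, A l) → ℝ) (b0 : ∀ j, B j)
    (w : ∀ i, A i → (∀ j, B j) → B i → ℝ) (N : Fin L → ℕ)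
    (hN : ∀ i, 0 < N i)
    (hsim : ∀ i (v : ∀ j, B j) (W : A i → B i → ℝ), ∃ f : A i → B i,
      (Finset.univ.image f).card ≤ N i ∧ ∑ a, W a (f a) ≤ ∑ a, ∑ b, w i a v b * W a b)
    (k : ℕ) :
    ∀ D : (∀ l, A l) → (∀ l, B l) → ℝ, ∃ f : ∀ i, A i → (∀ j, B j) → B i,
      (∀ i v, (Finset.univ.image (fun a => f i a v)).card ≤ N i) ∧
      ∑ s, P s * D s (stt f b0 s k) ≤ ∑ s, P s * Ew w b0 s k (D s) := by
  induction k with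
  | zero =>
    intro D
    refine ⟨fun i _ _ => b0 i, ?_, le_rfl⟩
    intro i v
    refine (Finset.card_le_card (t := {b0 i}) ?_).trans (by simpa using Nat.succ_le_of_lt (hN i))
    intro x hx
    simp only [Finset.mem_image] at hx
    obtain ⟨_, _, h⟩ := hx
    simp [h]
  | succ k ih =>
    intro D
    obtain ⟨f, hfN, hf⟩ := ih (fun s u => if h : k < L then
      ∑ b, w ⟨k, h⟩ (s ⟨k, h⟩) u b * D s (Function.update u ⟨k, h⟩ b) else D s u)
    by_cases hk : k < L
    · simp only [hk, dif_pos] at hf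
      choose fk hfkN hfk using fun v => hsim ⟨k, hk⟩ v (fun a b =>
        ∑ s ∈ Finset.univ.filter (fun s : ∀ l, A l => stt f b0 s k = v ∧ s ⟨k, hk⟩ = a),
          P s * D s (Function.update v ⟨k, hk⟩ b))
      have key : ∀ G : A ⟨k, hk⟩ → (∀ j, B j) → (∀ l, A l) → ℝ,
          ∑ v, ∑ a, ∑ s ∈ Finset.univ.filter
            (fun s : ∀ l, A l => stt f b0 s k = v ∧ s ⟨k, hk⟩ = a), G a v s =
          ∑ s, G (s ⟨k, hk⟩) (stt f b0 s k) s := by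
        intro G
        simp only [Finset.sum_filter, ite_and]
        simp only [Finset.sum_comm (s := (Finset.univ : Finset (A ⟨k, hk⟩)))]
        rw [Finset.sum_comm]
        apply Finset.sum_congr rfl
        intro s _
        rw [Finset.sum_eq_single (stt f b0 s k)]
        · simp
        · intro v _ hv
          simp [Ne.symm hv]
        · simp
      refine ⟨Function.update f ⟨k, hk⟩ (fun a v => fk v a), ?_, ?_⟩
      · intro i v
        by_cases hi : i = ⟨k, hk⟩
        · subst hi
          simpa using hfkN v
        · rw [Function.update_of_ne hi]
          exact hfN i v
      · simp only [Ew, hk, dif_pos]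
        refine le_trans ?_ hf
        have hst : ∀ s, stt (Function.update f ⟨k, hk⟩ (fun a v => fk v a)) b0 s (k + 1) =
            Function.update (stt f b0 s k) ⟨k, hk⟩ (fk (stt f b0 s k) (s ⟨k, hk⟩)) := by
          intro s
          simp only [stt, hk, dif_pos, Function.update_self]
          rw [stt_congr _ f b0 s k]
          intro i hi
          rw [Function.update_of_ne]
          intro h; subst h; simp at hi
        simp only [hst]
        have hsum := Finset.sum_le_sum fun v (_ : v ∈ (Finset.univ : Finset (∀ j, B j))) => hfk v
        rw [key (fun a v s => P s * D s (Function.update v ⟨k, hk⟩ (fk v a)))] at hsum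
        refine hsum.trans (le_of_eq ?_)
        simp only [Finset.mul_sum]
        have := key (fun a v s => ∑ b, w ⟨k, hk⟩ a v b * (P s * D s (Function.update v ⟨k, hk⟩ b)))
        simp only [Finset.sum_comm (s := (Finset.univ : Finset (B ⟨k, hk⟩)))] at this ⊢
        rw [this]
        apply Finset.sum_congr rfl
        intro b _
        apply Finset.sum_congr rfl
        intro s _
        ring
    · refine ⟨f, hfN, ?_⟩
      simp only [hk, dif_neg, not_false_eq_true] at hf
      simpa only [Ew, stt, hk, dif_neg, not_false_eq_true] using hf

end Seq

end Cascade
namespace Cascade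

set_option linter.unusedSectionVars false

/-! ### From deterministic strategies to a cascade code -/

section MkCode
variable {L : ℕ} {A B : Fin L → Type} [∀ l, Fintype (A l)] [∀ l, DecidableEq (A l)]
  [∀ l, Fintype (B l)] [∀ l, DecidableEq (B l)]

/-- Reachable states. -/
def reach (f : ∀ i, A i → (∀ j, B j) → B i) (b0 : ∀ j, B j) (k : ℕ) : Finset (∀ j, B j) :=
  Finset.univ.image (fun s => stt f b0 s k)

lemma reach_card_succ (f : ∀ i, A i → (∀ j, B j) → B i) (b0 : ∀ j, B j) (N : Fin L → ℕ)
    (hfN : ∀ i v, (Finset.univ.image (fun a => f i a v)).card ≤ N i) (k : ℕ) (hk : k < L) :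
    (reach f b0 (k + 1)).card ≤ (reach f b0 k).card * N ⟨k, hk⟩ := by
  have hsub : reach f b0 (k + 1) ⊆ (reach f b0 k).biUnion (fun v =>
      (Finset.univ.image (fun a => f ⟨k, hk⟩ a v)).image
        (fun b => Function.update v ⟨k, hk⟩ b)) := by
    intro x hx
    simp only [reach, Finset.mem_image, Finset.mem_univ, true_and, stt, hk, dif_pos] at hx
    obtain ⟨s, rfl⟩ := hx
    simp only [reach, Finset.mem_biUnion, Finset.mem_image, Finset.mem_univ, true_and]
    exact ⟨_, ⟨s, rfl⟩, _, ⟨s ⟨k, hk⟩, rfl⟩, rfl⟩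
  refine (Finset.card_le_card hsub).trans (Finset.card_biUnion_le_card_mul _ _ _ ?_)
  intro v _
  exact Finset.card_image_le.trans (hfN _ v)

lemma reach_card (f : ∀ i, A i → (∀ j, B j) → B i) (b0 : ∀ j, B j) (N : Fin L → ℕ)
    (hfN : ∀ i v, (Finset.univ.image (fun a => f i a v)).card ≤ N i) (k : ℕ) (hk : k ≤ L) :
    (reach f b0 k).card ≤ ∏ i ∈ Finset.univ.filter (fun i : Fin L => i.val < k), N i := by
  induction k with
  | zero =>
    refine (Finset.card_le_card (t := {b0}) ?_).trans (by simp)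
    intro x hx
    simp only [reach, Finset.mem_image, stt] at hx
    obtain ⟨_, _, h⟩ := hx
    simp [h]
  | succ k ih =>
    have hkL : k < L := hk
    have hset : (Finset.univ.filter (fun i : Fin L => i.val < k + 1)) =
        insert ⟨k, hkL⟩ (Finset.univ.filter (fun i : Fin L => i.val < k)) := by
      ext i
      simp only [Finset.mem_filter, Finset.mem_univ, true_and, Finset.mem_insert, Fin.ext_iff]
      omega
    rw [hset, Finset.prod_insert (by simp), mul_comm]
    exact (reach_card_succ f b0 N hfN k hkL).trans (Nat.mul_le_mul_right _ (ih hkL.le))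

lemma exists_index {γ : Type} [DecidableEq γ] [Inhabited γ] (R : Finset γ) (hR : 0 < R.card) :
    ∃ (idx : γ → Fin R.card) (st : ℕ → γ), ∀ x ∈ R, st (idx x) = x := by
  classical
  refine ⟨fun x => if h : x ∈ R then R.equivFin ⟨x, h⟩ else ⟨0, hR⟩,
    fun m => if h : m < R.card then (R.equivFin.symm ⟨m, h⟩).1 else default, ?_⟩
  intro x hx
  simp [hx]

end MkCode

lemma exists_code {L n : ℕ} {S U : Fin L → Type} [∀ l, Fintype (S l)] [∀ l, DecidableEq (S l)]
    [∀ l, Fintype (U l)] [∀ l, DecidableEq (U l)] {Zhat : Type} [Nonempty (∀ l, Fin n → S l)]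
    (g : (∀ l, U l) → Zhat)
    (f : ∀ i, (Fin n → S i) → (∀ j, Fin n → U j) → (Fin n → U i)) (b0 : ∀ j, Fin n → U j)
    (N : Fin L → ℕ)
    (hfN : ∀ i v, (Finset.univ.image (fun a => f i a v)).card ≤ N i) :
    ∃ c : Code L n S Zhat, (∀ l, c.M l ≤ ∏ i ∈ Finset.univ.filter (fun i : Fin L => i ≤ l), N i) ∧
      ∀ ω : Fin n → ∀ l, S l, reconstruct c ω =
        fun t => g (fun l => stt f b0 (fun l i => ω i l) L l t) := by
  have hpos : ∀ k, 0 < (reach f b0 k).card := by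
    intro k
    rw [Finset.card_pos]
    exact Finset.univ_nonempty.image _
  have : Inhabited (∀ j, Fin n → U j) := ⟨b0⟩
  choose idx st hst using fun k => exists_index (reach f b0 k) (hpos k)
  have hmem : ∀ s k, stt f b0 s k ∈ reach f b0 k := fun s k =>
    Finset.mem_image_of_mem _ (Finset.mem_univ s)
  let c : Code L n S Zhat :=
    { M := fun l => (reach f b0 (l.val + 1)).card
      M_pos := fun l => hpos _
      enc := fun l s m => idx (l.val + 1) (Function.update (st l.val m) l (f l s (st l.val m)))
      dec := fun m t => g (fun l => st L m l t) }
  have hmsg : ∀ s k, k ≤ L → msg c s k = (idx k (stt f b0 s k)).val := by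
    intro s k
    induction k with
    | zero =>
      intro _
      have h1 : (reach f b0 0).card ≤ 1 := by
        simpa using reach_card f b0 N hfN 0 (Nat.zero_le _)
      have := (idx 0 (stt f b0 s 0)).isLt
      simp only [msg]
      omega
    | succ k ih =>
      intro hk
      have hkL : k < L := hk
      have hs : stt f b0 s (k + 1) = Function.update (stt f b0 s k) ⟨k, hkL⟩
          (f ⟨k, hkL⟩ (s ⟨k, hkL⟩) (stt f b0 s k)) := by
        simp only [stt, hkL, dif_pos]
      rw [hs]
      simp only [msg, hkL, dif_pos]
      rw [ih hkL.le]
      simp only [c]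
      rw [hst k _ (hmem s k)]
  refine ⟨c, ?_, ?_⟩
  · intro l
    have := reach_card f b0 N hfN (l.val + 1) l.isLt
    have hset : (Finset.univ.filter (fun i : Fin L => i.val < l.val + 1)) =
        (Finset.univ.filter (fun i : Fin L => i ≤ l)) := by
      ext i
      simp only [Finset.mem_filter, Finset.mem_univ, true_and, Fin.le_def]
      omega
    rw [hset] at this
    exact this
  · intro ω
    funext t
    simp only [reconstruct]
    rw [hmsg _ L le_rfl]
    simp only [c]
    rw [hst L _ (hmem _ L)]

/-! ### Product measures and the Chernoff bound -/

lemma sum_prod_pi {n : ℕ} {Ω : Type} [Fintype Ω] (h : Fin n → Ω → ℝ) :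
    ∑ ω : Fin n → Ω, ∏ t, h t (ω t) = ∏ t, ∑ x, h t x := by
  rw [Finset.prod_univ_sum, Fintype.piFinset_univ]

lemma exists_chernoff {Ω : Type} [Fintype Ω] (μ : Ω → ℝ) (h0 : ∀ x, 0 ≤ μ x) (h1 : ∑ x, μ x = 1)
    (X : Ω → ℝ) (I δ : ℝ) (hδ : 0 < δ) (hX : ∑ x, μ x * X x = I) :
    ∃ θ : ℝ, 0 < θ ∧ ∑ x, μ x * Real.exp (θ * (X x - I - δ)) < 1 := by
  set K : ℝ := 1 + ∑ x, |X x - I - δ| with hK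
  have hKx : ∀ x, |X x - I - δ| ≤ K := by
    intro x
    have := Finset.single_le_sum (f := fun x => |X x - I - δ|) (fun i _ => abs_nonneg _)
      (Finset.mem_univ x)
    linarith
  have hK1 : 1 ≤ K := by
    have : 0 ≤ ∑ x, |X x - I - δ| := Finset.sum_nonneg fun _ _ => abs_nonneg _
    linarith
  have hK0 : 0 < K := by linarith
  obtain ⟨θ, hθ0, hθ1, hθ2⟩ : ∃ θ : ℝ, 0 < θ ∧ θ * K ≤ 1 ∧ θ * K ^ 2 < δ := by
    refine ⟨min (1 / K) (δ / (2 * K ^ 2)), by positivity, ?_, ?_⟩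
    · calc _ ≤ 1 / K * K := by gcongr; exact min_le_left _ _
        _ = 1 := by field_simp
    · calc _ ≤ δ / (2 * K ^ 2) * K ^ 2 := by gcongr; exact min_le_right _ _
        _ = δ / 2 := by field_simp
        _ < δ := by linarith
  refine ⟨θ, hθ0, ?_⟩
  have hb : ∀ x, Real.exp (θ * (X x - I - δ)) ≤ 1 + θ * (X x - I - δ) + θ ^ 2 * K ^ 2 := by
    intro x
    have ha : |θ * (X x - I - δ)| ≤ 1 := by
      rw [abs_mul, abs_of_pos hθ0]
      exact (mul_le_mul_of_nonneg_left (hKx x) hθ0.le).trans hθ1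
    have h2 := (abs_le.1 (Real.abs_exp_sub_one_sub_id_le ha)).2
    have h3 : (X x - I - δ) ^ 2 ≤ K ^ 2 := sq_le_sq' (by linarith [(abs_le.1 (hKx x)).1])
      (abs_le.1 (hKx x)).2
    have h4 : (θ * (X x - I - δ)) ^ 2 ≤ θ ^ 2 * K ^ 2 := by
      rw [mul_pow]; gcongr
    linarith
  calc ∑ x, μ x * Real.exp (θ * (X x - I - δ))
      ≤ ∑ x, μ x * (1 + θ * (X x - I - δ) + θ ^ 2 * K ^ 2) :=
        Finset.sum_le_sum fun x _ => mul_le_mul_of_nonneg_left (hb x) (h0 x)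
    _ = ∑ x, (θ * (μ x * X x) + μ x * (1 - θ * I - θ * δ + θ ^ 2 * K ^ 2)) := by
        apply Finset.sum_congr rfl; intro x _; ring
    _ = θ * I + (1 - θ * I - θ * δ + θ ^ 2 * K ^ 2) := by
        rw [Finset.sum_add_distrib, ← Finset.mul_sum, ← Finset.sum_mul, hX, h1, one_mul]
    _ < 1 := by nlinarith

/-- AEP in the form used below: `Q^n > 2^{n(I+δ)} r^n` has exponentially small probability. -/
lemma aep {Ω : Type} [Fintype Ω] (μ : Ω → ℝ) (h0 : ∀ x, 0 ≤ μ x) (h1 : ∑ x, μ x = 1)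
    (Q r : Ω → ℝ) (hQ : ∀ x, μ x ≠ 0 → 0 < Q x) (hr : ∀ x, μ x ≠ 0 → 0 < r x)
    (I δ : ℝ) (hδ : 0 < δ) (hX : ∑ x, μ x * Real.logb 2 (Q x / r x) = I) :
    ∃ ρ : ℝ, 0 ≤ ρ ∧ ρ < 1 ∧ ∀ n : ℕ, ∑ ω : Fin n → Ω, (∏ t, μ (ω t)) *
      (if ∏ t, Q (ω t) ≤ (2 : ℝ) ^ ((n : ℝ) * (I + δ)) * ∏ t, r (ω t) then 0 else 1) ≤ ρ ^ n := by
  obtain ⟨θ, hθ0, hθ⟩ := exists_chernoff μ h0 h1 _ I δ hδ hX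
  refine ⟨_, Finset.sum_nonneg fun x _ => mul_nonneg (h0 x) (Real.exp_pos _).le, hθ, ?_⟩
  intro n
  have e1 := sum_prod_pi (n := n)
    (fun _ x => μ x * Real.exp (θ * (Real.logb 2 (Q x / r x) - I - δ)))
  rw [Finset.prod_const, Finset.card_univ, Fintype.card_fin] at e1
  rw [← e1]
  apply Finset.sum_le_sum
  intro ω _
  rw [Finset.prod_mul_distrib]
  by_cases hz : ∏ t, μ (ω t) = 0
  · rw [hz]; simp
  have hne : ∀ t, μ (ω t) ≠ 0 := by
    intro t h
    exact hz (Finset.prod_eq_zero (Finset.mem_univ t) h)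
  apply mul_le_mul_of_nonneg_left _ (Finset.prod_nonneg fun t _ => h0 _)
  split_ifs with hc
  · exact Finset.prod_nonneg fun t _ => (Real.exp_pos _).le
  · rw [← Real.exp_sum, ← Finset.mul_sum]
    apply Real.one_le_exp
    apply mul_nonneg hθ0.le
    have hrp : 0 < ∏ t, r (ω t) := Finset.prod_pos fun t _ => hr _ (hne t)
    push Not at hc
    have h2 : (2 : ℝ) ^ ((n : ℝ) * (I + δ)) < ∏ t, (Q (ω t) / r (ω t)) := by
      rw [Finset.prod_div_distrib, lt_div_iff₀ hrp]
      exact hc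
    have h3 : (n : ℝ) * (I + δ) < ∑ t, Real.logb 2 (Q (ω t) / r (ω t)) := by
      rw [← Real.logb_prod]
      · rw [Real.lt_logb_iff_rpow_lt (by norm_num)]
        · exact h2
        · exact Finset.prod_pos fun t _ => div_pos (hQ _ (hne t)) (hr _ (hne t))
      · intro t _
        exact (div_pos (hQ _ (hne t)) (hr _ (hne t))).ne'
    rw [Finset.sum_sub_distrib, Finset.sum_sub_distrib]
    simp only [Finset.sum_const, Finset.card_univ, Fintype.card_fin, nsmul_eq_mul]
    linarith

lemma iid_avg {Ω : Type} [Fintype Ω] (μ : Ω → ℝ) (h1 : ∑ x, μ x = 1) (F : Ω → ℝ) (n : ℕ)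
    (hn : 0 < n) :
    ∑ ω : Fin n → Ω, (∏ t, μ (ω t)) * ((n : ℝ)⁻¹ * ∑ t, F (ω t)) = ∑ x, μ x * F x := by
  have key : ∀ t0 : Fin n, ∑ ω : Fin n → Ω, (∏ t, μ (ω t)) * F (ω t0) = ∑ x, μ x * F x := by
    intro t0
    have := sum_prod_pi (n := n) (fun t x => if t = t0 then μ x * F x else μ x)
    have h2 : ∀ t, ∑ x, (if t = t0 then μ x * F x else μ x) =
        if t = t0 then ∑ x, μ x * F x else 1 := by
      intro t; split_ifs
      · rfl
      · exact h1
    simp only [h2, Finset.prod_ite_eq', Finset.mem_univ, if_true] at this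
    rw [← this]
    apply Finset.sum_congr rfl
    intro ω _
    have h3 : ∀ t, (if t = t0 then μ (ω t) * F (ω t) else μ (ω t)) =
        μ (ω t) * (if t = t0 then F (ω t) else 1) := by
      intro t; split_ifs <;> simp
    simp only [h3, Finset.prod_mul_distrib, Finset.prod_ite_eq', Finset.mem_univ, if_true]
  have e : ∀ ω : Fin n → Ω, (∏ t, μ (ω t)) * ((n : ℝ)⁻¹ * ∑ t, F (ω t)) =
      (n : ℝ)⁻¹ * ∑ t0, (∏ t, μ (ω t)) * F (ω t0) := by
    intro ω; rw [← Finset.mul_sum]; ring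
  simp only [e]
  rw [← Finset.mul_sum, Finset.sum_comm]
  simp only [key, Finset.sum_const, Finset.card_univ, Fintype.card_fin, nsmul_eq_mul]
  have : (n : ℝ) ≠ 0 := by positivity
  field_simp

end Cascade
namespace Cascade

set_option linter.unusedSectionVars false

/-! ### Single-letter facts -/

section Letter

lemma prob_nonneg {Ω : Type} [Fintype Ω] (μ : FinPMF Ω) {α : Type} [DecidableEq α]
    (X : Ω → α) (x : α) : 0 ≤ prob μ X x :=
  Finset.sum_nonneg fun ω _ => μ.nonneg ω

lemma le_prob {Ω : Type} [Fintype Ω] (μ : FinPMF Ω) {α : Type} [DecidableEq α]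
    (X : Ω → α) (ω : Ω) : μ.p ω ≤ prob μ X (X ω) := by
  apply Finset.single_le_sum (f := μ.p) (fun ω _ => μ.nonneg ω)
  simp

lemma prob_pos {Ω : Type} [Fintype Ω] (μ : FinPMF Ω) {α : Type} [DecidableEq α]
    (X : Ω → α) (ω : Ω) (h : μ.p ω ≠ 0) : 0 < prob μ X (X ω) :=
  lt_of_lt_of_le (lt_of_le_of_ne (μ.nonneg ω) (Ne.symm h)) (le_prob μ X ω)

lemma entropy_eq {Ω : Type} [Fintype Ω] (μ : FinPMF Ω) {α : Type} [Fintype α] [DecidableEq α]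
    (X : Ω → α) : entropy μ X = -∑ ω, μ.p ω * Real.logb 2 (prob μ X (X ω)) := by
  unfold entropy
  congr 1
  rw [← Finset.sum_fiberwise Finset.univ X]
  apply Finset.sum_congr rfl
  intro x _
  conv_lhs => rw [prob, Finset.sum_mul]
  apply Finset.sum_congr rfl
  intro ω hω
  simp only [Finset.mem_filter, Finset.mem_univ, true_and] at hω
  rw [hω]
  rfl

lemma sum_prob_pair {Ω : Type} [Fintype Ω] (μ : FinPMF Ω) {α β : Type} [Fintype α] [DecidableEq α]
    [DecidableEq β] (X : Ω → α) (Y : Ω → β) (y : β) :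
    ∑ x, prob μ (fun ω => (X ω, Y ω)) (x, y) = prob μ Y y := by
  simp only [prob, Finset.sum_filter, Prod.mk.injEq]
  rw [Finset.sum_comm]
  apply Finset.sum_congr rfl
  intro ω _
  simp [ite_and]

variable {L : ℕ} {S U : Fin L → Type}
    [∀ l, Fintype (S l)] [∀ l, DecidableEq (S l)]
    [∀ l, Fintype (U l)] [∀ l, DecidableEq (U l)]

/-- History of the auxiliaries before stage `i`. -/
def hist (i : Fin L) (u : ∀ l, U l) : ∀ j : Fin L, Option (U j) :=
  fun j => if j < i then some (u j) else none

lemma hist_congr (i : Fin L) (u u' : ∀ l, U l) (h : ∀ j, j < i → u j = u' j) :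
    hist i u = hist i u' := by
  funext j
  simp only [hist]
  split_ifs with hj
  · rw [h j hj]
  · rfl

lemma markov_aux (Q : ∀ l, U l → ℝ) (hQ1 : ∀ l, ∑ b, Q l b = 1) (i : Fin L) (b : U i)
    (v : ∀ j : Fin L, Option (U j)) :
    ∑ u : ∀ l, U l, (if u i = b ∧ hist i u = v then ∏ l, Q l (u l) else 0) =
      Q i b * ∑ u : ∀ l, U l, (if hist i u = v then ∏ l, Q l (u l) else 0) := by
  let c : ∀ l, U l → ℝ := fun l x => if (if l < i then some x else none) = v l then Q l x else 0
  have hc : ∀ u : ∀ l, U l, (if hist i u = v then ∏ l, Q l (u l) else 0) = ∏ l, c l (u l) := by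
    intro u
    by_cases h : hist i u = v
    · rw [if_pos h]
      apply Finset.prod_congr rfl
      intro l _
      have : (if l < i then some (u l) else none) = v l := congrFun h l
      simp only [c]
      rw [if_pos this]
    · rw [if_neg h]
      obtain ⟨l, hl⟩ := Function.ne_iff.1 h
      symm
      apply Finset.prod_eq_zero (Finset.mem_univ l)
      simp only [c]
      exact if_neg hl
  let c' : ∀ l, U l → ℝ := Function.update c i (fun x => if x = b then c i x else 0)
  have hc' : ∀ u : ∀ l, U l, (if u i = b ∧ hist i u = v then ∏ l, Q l (u l) else 0) =
      ∏ l, c' l (u l) := by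
    intro u
    rw [ite_and, hc u]
    rw [← Finset.mul_prod_erase _ _ (Finset.mem_univ i),
      ← Finset.mul_prod_erase _ (fun l => c' l (u l)) (Finset.mem_univ i)]
    have h1 : ∏ l ∈ Finset.univ.erase i, c' l (u l) = ∏ l ∈ Finset.univ.erase i, c l (u l) := by
      apply Finset.prod_congr rfl
      intro l hl
      simp only [c']
      rw [Function.update_of_ne (Finset.ne_of_mem_erase hl)]
    rw [h1]
    simp only [c', Function.update_self]
    split_ifs <;> simp
  simp only [hc, hc']
  have hs : ∀ C : ∀ l, U l → ℝ, ∑ u : ∀ l, U l, ∏ l, C l (u l) = ∏ l, ∑ x, C l x := by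
    intro C
    rw [Finset.prod_univ_sum, Fintype.piFinset_univ]
  rw [hs, hs]
  rw [← Finset.mul_prod_erase _ _ (Finset.mem_univ i),
      ← Finset.mul_prod_erase _ (fun l => ∑ x, c l x) (Finset.mem_univ i)]
  have h1 : ∏ l ∈ Finset.univ.erase i, ∑ x, c' l x = ∏ l ∈ Finset.univ.erase i, ∑ x, c l x := by
    apply Finset.prod_congr rfl
    intro l hl
    simp only [c']
    rw [Function.update_of_ne (Finset.ne_of_mem_erase hl)]
  rw [h1, ← mul_assoc]
  congr 1
  simp only [c', Function.update_self, Finset.sum_ite_eq', Finset.mem_univ, if_true]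
  simp only [c, lt_irrefl, if_false]
  by_cases h : none = v i
  · simp [h, hQ1]
  · simp [h]

variable (pS : (∀ l, S l) → ℝ) (μ : FinPMF ((∀ l, S l) × (∀ l, U l)))
    (q : (l : Fin L) → S l → U l → ℝ)

lemma markov (hq1 : ∀ l s, ∑ u, q l s u = 1)
    (hfact : ∀ s u, μ.p (s, u) = pS s * ∏ l, q l (s l) (u l)) (i : Fin L) (a : S i) (b : U i)
    (v : ∀ j : Fin L, Option (U j)) :
    prob μ (fun ω => (ω.1 i, ω.2 i, hist i ω.2)) (a, b, v) =
      q i a b * prob μ (fun ω => (ω.1 i, hist i ω.2)) (a, v) := by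
  simp only [prob, Finset.sum_filter, Prod.mk.injEq]
  rw [Fintype.sum_prod_type, Fintype.sum_prod_type, Finset.mul_sum]
  apply Finset.sum_congr rfl
  intro s _
  simp only [hfact]
  by_cases hs : s i = a
  · subst hs
    simp only [true_and]
    have := markov_aux (fun l => q l (s l)) (fun l => hq1 l _) i b v
    have e : ∀ (p : Prop) [Decidable p] (x : ℝ), (if p then pS s * x else 0) =
        pS s * (if p then x else 0) := by
      intro p _ x; split_ifs <;> simp
    simp only [e, ← Finset.mul_sum, this]
    ring
  · simp [hs]

/-- Conditional law of `U_i` given `U_{<i}`. -/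
noncomputable def rk (s0 : ∀ l, S l) (i : Fin L) (v : ∀ j, U j) (b : U i) : ℝ :=
  if prob μ (fun ω => hist i ω.2) (hist i v) = 0 then q i (s0 i) b
  else prob μ (fun ω => (ω.2 i, hist i ω.2)) (b, hist i v) /
    prob μ (fun ω => hist i ω.2) (hist i v)

lemma rk_nonneg (hq0 : ∀ l s u, 0 ≤ q l s u) (s0 : ∀ l, S l) (i : Fin L) (v : ∀ j, U j)
    (b : U i) : 0 ≤ rk μ q s0 i v b := by
  unfold rk
  split_ifs
  · exact hq0 _ _ _
  · exact div_nonneg (prob_nonneg _ _ _) (prob_nonneg _ _ _)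

lemma rk_sum (hq1 : ∀ l s, ∑ u, q l s u = 1) (s0 : ∀ l, S l) (i : Fin L) (v : ∀ j, U j) :
    ∑ b, rk μ q s0 i v b = 1 := by
  unfold rk
  split_ifs with h
  · exact hq1 _ _
  · rw [← Finset.sum_div, sum_prob_pair μ (fun ω => ω.2 i) (fun ω => hist i ω.2), div_self h]

lemma rk_local (s0 : ∀ l, S l) (i : Fin L) (v v' : ∀ j, U j) (b : U i)
    (h : ∀ j, j < i → v j = v' j) : rk μ q s0 i v b = rk μ q s0 i v' b := by
  unfold rk
  rw [hist_congr i v v' h]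

lemma rk_mul (s0 : ∀ l, S l) (i : Fin L) (ω : (∀ l, S l) × (∀ l, U l)) (h : μ.p ω ≠ 0) :
    rk μ q s0 i ω.2 (ω.2 i) * prob μ (fun ω => hist i ω.2) (hist i ω.2) =
      prob μ (fun ω => (ω.2 i, hist i ω.2)) (ω.2 i, hist i ω.2) := by
  have hp := prob_pos μ (fun ω => hist i ω.2) ω h
  unfold rk
  rw [if_neg hp.ne', div_mul_cancel₀ _ hp.ne']

lemma rk_pos (s0 : ∀ l, S l) (i : Fin L) (ω : (∀ l, S l) × (∀ l, U l)) (h : μ.p ω ≠ 0) :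
    0 < rk μ q s0 i ω.2 (ω.2 i) := by
  have hp := prob_pos μ (fun ω => hist i ω.2) ω h
  have hp2 := prob_pos μ (fun ω => (ω.2 i, hist i ω.2)) ω h
  unfold rk
  rw [if_neg hp.ne']
  exact div_pos hp2 hp

lemma q_pos (hq0 : ∀ l s u, 0 ≤ q l s u)
    (hfact : ∀ s u, μ.p (s, u) = pS s * ∏ l, q l (s l) (u l)) (i : Fin L)
    (ω : (∀ l, S l) × (∀ l, U l)) (h : μ.p ω ≠ 0) : 0 < q i (ω.1 i) (ω.2 i) := by
  refine lt_of_le_of_ne (hq0 _ _ _) fun h0 => h ?_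
  obtain ⟨s, u⟩ := ω
  rw [hfact, Finset.prod_eq_zero (Finset.mem_univ i) h0.symm, mul_zero]

lemma info_eq (hq0 : ∀ l s u, 0 ≤ q l s u) (hq1 : ∀ l s, ∑ u, q l s u = 1)
    (hfact : ∀ s u, μ.p (s, u) = pS s * ∏ l, q l (s l) (u l)) (s0 : ∀ l, S l) (i : Fin L) :
    ∑ ω, μ.p ω * Real.logb 2 (q i (ω.1 i) (ω.2 i) / rk μ q s0 i ω.2 (ω.2 i)) =
      condMI μ (fun ω => ω.1 i) (fun ω => ω.2 i)
          (fun ω => fun j => if j < i then some (ω.2 j) else none) := by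
  change _ = condMI μ (fun ω => ω.1 i) (fun ω => ω.2 i) (fun ω => hist i ω.2)
  unfold condMI
  simp only [entropy_eq]
  have key : ∀ ω, μ.p ω * Real.logb 2 (q i (ω.1 i) (ω.2 i) / rk μ q s0 i ω.2 (ω.2 i)) =
      μ.p ω * Real.logb 2 (prob μ (fun ω => (ω.1 i, ω.2 i, hist i ω.2))
        (ω.1 i, ω.2 i, hist i ω.2)) +
      μ.p ω * Real.logb 2 (prob μ (fun ω => hist i ω.2) (hist i ω.2)) -
      μ.p ω * Real.logb 2 (prob μ (fun ω => (ω.1 i, hist i ω.2)) (ω.1 i, hist i ω.2)) -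
      μ.p ω * Real.logb 2 (prob μ (fun ω => (ω.2 i, hist i ω.2)) (ω.2 i, hist i ω.2)) := by
    intro ω
    by_cases h : μ.p ω = 0
    · simp [h]
    have hm := markov pS μ q hq1 hfact i (ω.1 i) (ω.2 i) (hist i ω.2)
    have hr := rk_mul μ q s0 i ω h
    have hqp := q_pos pS μ q hq0 hfact i ω h
    have hrp := rk_pos μ q s0 i ω h
    have h1 := prob_pos μ (fun ω => hist i ω.2) ω h
    have h2 := prob_pos μ (fun ω => (ω.1 i, hist i ω.2)) ω h
    rw [hm, ← hr, Real.logb_div hqp.ne' hrp.ne', Real.logb_mul hqp.ne' h2.ne',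
      Real.logb_mul hrp.ne' h1.ne']
    ring
  simp only [key]
  rw [Finset.sum_sub_distrib, Finset.sum_sub_distrib, Finset.sum_add_distrib]
  ring

lemma info_nonneg (hpS0 : ∀ s, 0 ≤ pS s) (hpS1 : ∑ s, pS s = 1)
    (hq0 : ∀ l s u, 0 ≤ q l s u) (hq1 : ∀ l s, ∑ u, q l s u = 1)
    (hfact : ∀ s u, μ.p (s, u) = pS s * ∏ l, q l (s l) (u l)) (s0 : ∀ l, S l) (u0 : ∀ l, U l)
    (i : Fin L) :
    0 ≤ ∑ ω, μ.p ω * Real.logb 2 (q i (ω.1 i) (ω.2 i) / rk μ q s0 i ω.2 (ω.2 i)) := by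
  let w : ∀ l, S l → (∀ j, U j) → U l → ℝ := fun l a v b =>
    if l = i then rk μ q s0 l v b else q l a b
  have hw0 : ∀ l a v b, 0 ≤ w l a v b := by
    intro l a v b; simp only [w]; split_ifs
    · exact rk_nonneg μ q hq0 _ _ _ _
    · exact hq0 _ _ _
  have hw1 : ∀ l a v, ∑ b, w l a v b = 1 := by
    intro l a v; simp only [w]; split_ifs
    · exact rk_sum μ q hq1 _ _ _
    · exact hq1 _ _
  have hloc : ∀ l a u u' b, (∀ j, j < l → u j = u' j) → w l a u b = w l a u' b := by
    intro l a u u' b h; simp only [w]; rw [rk_local μ q s0 l u u' b h]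
  have hsum : ∑ ω : (∀ l, S l) × (∀ l, U l), pS ω.1 * ∏ l, w l (ω.1 l) ω.2 (ω.2 l) = 1 := by
    rw [Fintype.sum_prod_type]
    simp only [← Finset.mul_sum]
    have : ∀ s : ∀ l, S l, ∑ u : ∀ l, U l, ∏ l, w l (s l) u (u l) = 1 := by
      intro s
      have h := Ew_unroll w hloc u0 s (fun _ => 1)
      rw [Ew_const w hw1] at h
      simpa using h.symm
    simp only [this, mul_one, hpS1]
  have hpt : ∀ ω, μ.p ω - pS ω.1 * ∏ l, w l (ω.1 l) ω.2 (ω.2 l) ≤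
      μ.p ω * Real.log (q i (ω.1 i) (ω.2 i) / rk μ q s0 i ω.2 (ω.2 i)) := by
    intro ω
    by_cases h : μ.p ω = 0
    · rw [h]
      have := mul_nonneg (hpS0 ω.1) (Finset.prod_nonneg fun l (_ : l ∈ Finset.univ) =>
        hw0 l (ω.1 l) ω.2 (ω.2 l))
      linarith
    have hqp := q_pos pS μ q hq0 hfact i ω h
    have hrp := rk_pos μ q s0 i ω h
    have hl := Real.one_sub_inv_le_log_of_pos (div_pos hqp hrp)
    refine le_trans (le_of_eq ?_) (mul_le_mul_of_nonneg_left hl (μ.nonneg ω))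
    rw [mul_sub, mul_one]
    congr 1
    obtain ⟨s, u⟩ := ω
    rw [hfact, ← Finset.mul_prod_erase _ _ (Finset.mem_univ i),
      ← Finset.mul_prod_erase _ (fun l => q l (s l) (u l)) (Finset.mem_univ i)]
    have : ∏ l ∈ Finset.univ.erase i, w l (s l) u (u l) =
        ∏ l ∈ Finset.univ.erase i, q l (s l) (u l) := by
      apply Finset.prod_congr rfl
      intro l hl
      simp only [w]
      rw [if_neg (Finset.ne_of_mem_erase hl)]
    simp only [this]
    simp only [w, if_true]
    simp only at hqp hrp
    field_simp
  have htot := Finset.sum_le_sum fun ω (_ : ω ∈ Finset.univ) => hpt ω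
  rw [Finset.sum_sub_distrib, μ.sum_one, hsum, sub_self] at htot
  have : ∑ ω, μ.p ω * Real.logb 2 (q i (ω.1 i) (ω.2 i) / rk μ q s0 i ω.2 (ω.2 i)) =
      (∑ ω, μ.p ω * Real.log (q i (ω.1 i) (ω.2 i) / rk μ q s0 i ω.2 (ω.2 i))) / Real.log 2 := by
    rw [Finset.sum_div]
    apply Finset.sum_congr rfl
    intro ω _
    rw [Real.logb, mul_div_assoc]
  rw [this]
  exact div_nonneg htot (Real.log_pos (by norm_num)).le

end Letter

end Cascade
namespace Cascade

set_option linter.unusedSectionVars false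

/-! ### Block-level bound -/

section Block
variable {L : ℕ} {S U : Fin L → Type}
    [∀ l, Fintype (S l)] [∀ l, DecidableEq (S l)]
    [∀ l, Fintype (U l)] [∀ l, DecidableEq (U l)]

lemma swap_sum {n : ℕ} (F : (∀ l, Fin n → S l) → (∀ l, Fin n → U l) → ℝ) :
    ∑ s, ∑ u, F s u = ∑ ω : Fin n → (∀ l, S l) × (∀ l, U l),
      F (fun l t => (ω t).1 l) (fun l t => (ω t).2 l) := by
  rw [← Fintype.sum_prod_type']
  exact Fintype.sum_equiv
    { toFun := fun x t => (fun l => x.1 l t, fun l => x.2 l t)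
      invFun := fun ω => (fun l t => (ω t).1 l, fun l t => (ω t).2 l)
      left_inv := fun _ => rfl
      right_inv := fun _ => rfl } _ _ (fun _ => rfl)

lemma swap_sum_one {n : ℕ} (F : (∀ l, Fin n → S l) → ℝ) :
    ∑ s, F s = ∑ ω : Fin n → (∀ l, S l), F (fun l t => ω t l) := by
  exact Fintype.sum_equiv
    { toFun := fun x t l => x l t
      invFun := fun ω l t => ω t l
      left_inv := fun _ => rfl
      right_inv := fun _ => rfl } _ _ (fun _ => rfl)

lemma pow_fail (T : ℝ) (hT : 1 ≤ T) (n K : ℕ) (hK : n * T ≤ K) :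
    (1 - 1 / T) ^ K ≤ Real.exp (-(n : ℝ)) := by
  have hT0 : 0 < T := by linarith
  have h3 : 0 ≤ 1 - 1 / T := by
    rw [sub_nonneg, div_le_one hT0]; exact hT
  calc (1 - 1 / T) ^ K ≤ (Real.exp (-(1 / T))) ^ K :=
        pow_le_pow_left₀ h3 (Real.one_sub_le_exp_neg _) _
    _ = Real.exp (-(K / T)) := by
        rw [← Real.exp_nat_mul]; congr 1; ring
    _ ≤ _ := by
        apply Real.exp_le_exp.2
        have : (n : ℝ) ≤ K / T := by rw [le_div_iff₀ hT0]; exact hK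
        linarith

lemma block_bound {n : ℕ} (hn : 0 < n)
    (pS : (∀ l, S l) → ℝ) (hpS0 : ∀ s, 0 ≤ pS s) (hpS1 : ∑ s, pS s = 1)
    (μ : FinPMF ((∀ l, S l) × (∀ l, U l)))
    (q : (l : Fin L) → S l → U l → ℝ) (hq0 : ∀ l s u, 0 ≤ q l s u)
    (hq1 : ∀ l s, ∑ u, q l s u = 1)
    (hfact : ∀ s u, μ.p (s, u) = pS s * ∏ l, q l (s l) (u l))
    (r : ∀ i : Fin L, (∀ j, U j) → U i → ℝ) (hr0 : ∀ i v b, 0 ≤ r i v b)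
    (hr1 : ∀ i v, ∑ b, r i v b = 1)
    (hloc : ∀ i v v' b, (∀ j, j < i → v j = v' j) → r i v b = r i v' b)
    (T : Fin L → ℝ) (hT : ∀ i, 1 ≤ T i) (K : Fin L → ℕ) (hK : ∀ i, n * T i ≤ K i)
    (ρ : Fin L → ℝ)
    (hρ : ∀ i, ∑ ω : Fin n → (∀ l, S l) × (∀ l, U l), (∏ t, μ.p (ω t)) *
      (if ∏ t, q i ((ω t).1 i) ((ω t).2 i) ≤ T i * ∏ t, r i (ω t).2 ((ω t).2 i)
        then 0 else 1) ≤ ρ i)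
    (F : (∀ l, S l) → (∀ l, U l) → ℝ) (hF0 : ∀ s u, 0 ≤ F s u) (dm : ℝ) (hFm : ∀ s u, F s u ≤ dm)
    (hdm : 0 ≤ dm) (b0 : ∀ j, Fin n → U j) :
    ∑ s : ∀ l, Fin n → S l, (∏ t, pS (fun l => s l t)) *
      Ew (fun i (a : Fin n → S i) (v : ∀ j, Fin n → U j) (b : Fin n → U i) =>
        lam (fun b : Fin n → U i => ∏ t, r i (fun j => v j t) (b t))
        (fun b => ∏ t, q i (a t) (b t)) (T i) (b0 i) (K i) b) b0 s L
        (fun u => (n : ℝ)⁻¹ * ∑ t, F (fun l => s l t) (fun l => u l t)) ≤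
    ∑ ω, μ.p ω * F ω.1 ω.2 +
      dm * ((1 - (1 - Real.exp (-(n : ℝ))) ^ L) + ∑ i, ρ i) := by
  set x : ℝ := 1 - Real.exp (-(n : ℝ)) with hx
  have hx1 : x ≤ 1 := by have := Real.exp_pos (-(n : ℝ)); linarith
  have hx0 : 0 ≤ x := by
    have : Real.exp (-(n : ℝ)) ≤ 1 := Real.exp_le_one_iff.2 (by simp)
    linarith
  have hn0 : (n : ℝ) ≠ 0 := by positivity
  set rn : ∀ i : Fin L, (∀ j, Fin n → U j) → (Fin n → U i) → ℝ :=
    fun i v b => ∏ t, r i (fun j => v j t) (b t) with hrn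
  set qn : ∀ i : Fin L, (Fin n → S i) → (Fin n → U i) → ℝ :=
    fun i a b => ∏ t, q i (a t) (b t) with hqn
  have hrn0 : ∀ i v b, 0 ≤ rn i v b := fun i v b => Finset.prod_nonneg fun t _ => hr0 _ _ _
  have hqn0 : ∀ i a b, 0 ≤ qn i a b := fun i v b => Finset.prod_nonneg fun t _ => hq0 _ _ _
  have hrn1 : ∀ i v, ∑ b, rn i v b = 1 := by
    intro i v
    simp only [hrn]
    rw [sum_prod_pi (fun t b => r i (fun j => v j t) b)]
    simp [hr1]
  have hqn1 : ∀ i a, ∑ b, qn i a b = 1 := by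
    intro i a
    simp only [hqn]
    rw [sum_prod_pi (fun t b => q i (a t) b)]
    simp [hq1]
  set lm : ∀ i, (Fin n → S i) → (∀ j, Fin n → U j) → (Fin n → U i) → ℝ :=
    fun i a v b => lam (rn i v) (qn i a) (T i) (b0 i) (K i) b with hlm
  let w : ∀ i, (Fin n → S i) → (∀ j, Fin n → U j) → (Fin n → U i) → ℝ :=
    fun i a v b => x * (qn i a b * if qn i a b ≤ T i * rn i v b then 1 else 0)
  have hw0 : ∀ i a v b, 0 ≤ w i a v b := by
    intro i a v b
    simp only [w]
    have := hqn0 i a b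
    split_ifs
    · positivity
    · simp
  have hwl : ∀ i a v b, w i a v b ≤ lm i a v b := by
    intro i a v b
    simp only [w, hlm]
    have hl0 := lam_nonneg (rn i v) (qn i a) (hrn0 i v) (hrn1 i v) (hqn0 i a) (T i) (hT i)
      (b0 i) (K i) b
    have hl := lam_lower (rn i v) (qn i a) (hrn0 i v) (hrn1 i v) (hqn0 i a) (hqn1 i a) (T i) (hT i)
      (b0 i) (K i) b
    have hTp : 0 < T i := by have := hT i; linarith
    split_ifs with hc
    · refine le_trans ?_ hl
      have : min (rn i v b) (qn i a b / T i) = qn i a b / T i := by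
        apply min_eq_right
        rw [div_le_iff₀ hTp]; linarith
      rw [this, mul_div_cancel₀ _ hTp.ne', mul_one]
      apply mul_le_mul_of_nonneg_right _ (hqn0 _ _ _)
      have := pow_fail (T i) (hT i) n (K i) (hK i)
      linarith
    · simpa using hl0
  have hlm1 : ∀ i a v, ∑ b, lm i a v b = 1 := fun i a v => lam_sum _ _ _ _ _
  have hwloc : ∀ i a u u' b, (∀ j, j < i → u j = u' j) → w i a u b = w i a u' b := by
    intro i a u u' b h
    have : rn i u b = rn i u' b := by
      simp only [hrn]
      apply Finset.prod_congr rfl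
      intro t _
      apply hloc
      intro j hj
      rw [h j hj]
    simp only [w, this]
  let Dn : (∀ l, Fin n → S l) → (∀ l, Fin n → U l) → ℝ := fun s u =>
    (n : ℝ)⁻¹ * ∑ t, F (fun l => s l t) (fun l => u l t)
  have hDn0 : ∀ s u, 0 ≤ Dn s u := fun s u =>
    mul_nonneg (by positivity) (Finset.sum_nonneg fun t _ => hF0 _ _)
  have hDnm : ∀ s u, Dn s u ≤ dm := by
    intro s u
    have : ∑ t : Fin n, F (fun l => s l t) (fun l => u l t) ≤ ∑ t : Fin n, dm :=
      Finset.sum_le_sum fun t _ => hFm _ _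
    simp only [Finset.sum_const, Finset.card_univ, Fintype.card_fin, nsmul_eq_mul] at this
    calc Dn s u ≤ (n : ℝ)⁻¹ * (n * dm) := mul_le_mul_of_nonneg_left this (by positivity)
      _ = dm := by field_simp
  let P : (∀ l, Fin n → S l) → ℝ := fun s => ∏ t, pS (fun l => s l t)
  have hP0 : ∀ s, 0 ≤ P s := fun s => Finset.prod_nonneg fun t _ => hpS0 _
  have hP1 : ∑ s, P s = 1 := by
    rw [swap_sum_one]
    simp only [P]
    rw [sum_prod_pi (fun _ s => pS s)]
    simp [hpS1]
  let at' : ∀ i : Fin L, (∀ l, Fin n → S l) → (∀ l, Fin n → U l) → ℝ := fun i s u =>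
    if qn i (s i) (u i) ≤ T i * rn i u (u i) then 0 else 1
  have hat0 : ∀ i s u, 0 ≤ at' i s u := by
    intro i s u; simp only [at']; split_ifs <;> norm_num
  -- pointwise bound on the evaluation
  have hEw : ∀ s, Ew lm b0 s L (Dn s) ≤ dm - x ^ L *
      ∑ u : ∀ l, Fin n → U l, (∏ i, qn i (s i) (u i)) * (dm - Dn s u - dm * ∑ i, at' i s u) := by
    intro s
    have h1 := Ew_const_sub lm hlm1 b0 s dm L (Dn s)
    have h2 := Ew_mono_w w lm hw0 hwl b0 s L (fun u => dm - Dn s u)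
      (fun u => by have := hDnm s u; linarith)
    rw [Ew_unroll w hwloc] at h2
    have h3 : x ^ L * ∑ u : ∀ l, Fin n → U l, (∏ i, qn i (s i) (u i)) *
        (dm - Dn s u - dm * ∑ i, at' i s u) ≤
        ∑ u, (∏ i, w i (s i) u (u i)) * (dm - Dn s u) := by
      rw [Finset.mul_sum]
      apply Finset.sum_le_sum
      intro u _
      have hprod : ∏ i, w i (s i) u (u i) = x ^ L * ((∏ i, qn i (s i) (u i)) *
          ∏ i, if qn i (s i) (u i) ≤ T i * rn i u (u i) then (1 : ℝ) else 0) := by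
        simp only [w, Finset.prod_mul_distrib, Finset.prod_const, Finset.card_univ,
          Fintype.card_fin]
      rw [hprod, mul_assoc, mul_assoc]
      apply mul_le_mul_of_nonneg_left _ (pow_nonneg hx0 _)
      apply mul_le_mul_of_nonneg_left _ (Finset.prod_nonneg fun i _ => hqn0 _ _ _)
      have hd1 := hDnm s u
      have hd0 := hDn0 s u
      by_cases hall : ∀ i, qn i (s i) (u i) ≤ T i * rn i u (u i)
      · have : ∏ i, (if qn i (s i) (u i) ≤ T i * rn i u (u i) then (1 : ℝ) else 0) = 1 :=
          Finset.prod_eq_one fun i _ => if_pos (hall i)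
        rw [this, one_mul]
        have : 0 ≤ dm * ∑ i, at' i s u :=
          mul_nonneg hdm (Finset.sum_nonneg fun i _ => hat0 _ _ _)
        linarith
      · push Not at hall
        obtain ⟨i, hi⟩ := hall
        have h4 : ∏ i, (if qn i (s i) (u i) ≤ T i * rn i u (u i) then (1 : ℝ) else 0) = 0 :=
          Finset.prod_eq_zero (Finset.mem_univ i) (if_neg (not_le.2 hi))
        rw [h4, zero_mul]
        have h5 : at' i s u = 1 := if_neg (not_le.2 hi)
        have h6 : at' i s u ≤ ∑ i, at' i s u :=
          Finset.single_le_sum (f := fun i => at' i s u) (fun i _ => hat0 i s u)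
            (Finset.mem_univ i)
        rw [h5] at h6
        nlinarith
    linarith
  -- sum it up
  have hswap : ∀ G : (∀ l, Fin n → S l) → (∀ l, Fin n → U l) → ℝ,
      ∑ s, P s * ∑ u : ∀ l, Fin n → U l, (∏ i, qn i (s i) (u i)) * G s u =
      ∑ ω : Fin n → (∀ l, S l) × (∀ l, U l), (∏ t, μ.p (ω t)) *
        G (fun l t => (ω t).1 l) (fun l t => (ω t).2 l) := by
    intro G
    simp only [Finset.mul_sum]
    rw [swap_sum (fun s u => P s * ((∏ i, qn i (s i) (u i)) * G s u))]
    apply Finset.sum_congr rfl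
    intro ω _
    rw [← mul_assoc]
    congr 1
    simp only [P, hqn]
    rw [Finset.prod_comm, ← Finset.prod_mul_distrib]
    apply Finset.prod_congr rfl
    intro t _
    exact (hfact _ _).symm
  have hE := iid_avg μ.p μ.sum_one (fun ω => F ω.1 ω.2) n hn
  have hone : ∑ ω : Fin n → (∀ l, S l) × (∀ l, U l), ∏ t, μ.p (ω t) = 1 := by
    rw [sum_prod_pi (fun _ y => μ.p y)]
    simp [μ.sum_one]
  have hmain := hswap (fun s u => dm - Dn s u - dm * ∑ i, at' i s u)
  have hlow : dm - ∑ ω, μ.p ω * F ω.1 ω.2 - dm * ∑ i, ρ i ≤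
      ∑ s, P s * ∑ u : ∀ l, Fin n → U l, (∏ i, qn i (s i) (u i)) *
        (dm - Dn s u - dm * ∑ i, at' i s u) := by
    rw [hmain]
    simp only [mul_sub, Finset.sum_sub_distrib]
    rw [← Finset.sum_mul, hone, one_mul]
    have e1 : ∑ ω : Fin n → (∀ l, S l) × (∀ l, U l), (∏ t, μ.p (ω t)) *
        Dn (fun l t => (ω t).1 l) (fun l t => (ω t).2 l) = ∑ ω, μ.p ω * F ω.1 ω.2 := hE
    rw [e1]
    have e2 : ∑ ω : Fin n → (∀ l, S l) × (∀ l, U l), (∏ t, μ.p (ω t)) *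
        (dm * ∑ i, at' i (fun l t => (ω t).1 l) (fun l t => (ω t).2 l)) ≤ dm * ∑ i, ρ i := by
      calc _ = dm * ∑ i, ∑ ω : Fin n → (∀ l, S l) × (∀ l, U l), (∏ t, μ.p (ω t)) *
              at' i (fun l t => (ω t).1 l) (fun l t => (ω t).2 l) := by
            rw [Finset.sum_comm, Finset.mul_sum]
            apply Finset.sum_congr rfl
            intro ω _
            rw [← Finset.mul_sum]
            ring
        _ ≤ _ := by
            apply mul_le_mul_of_nonneg_left _ hdm
            exact Finset.sum_le_sum fun i _ => hρ i
    linarith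
  have hup : ∑ s, P s * Ew lm b0 s L (Dn s) ≤ dm - x ^ L *
      ∑ s, P s * ∑ u : ∀ l, Fin n → U l, (∏ i, qn i (s i) (u i)) *
        (dm - Dn s u - dm * ∑ i, at' i s u) := by
    refine (Finset.sum_le_sum fun s _ => mul_le_mul_of_nonneg_left (hEw s) (hP0 s)).trans
      (le_of_eq ?_)
    set H : (∀ l, Fin n → S l) → ℝ := (fun s => ∑ u : ∀ l, Fin n → U l, (∏ i, qn i (s i) (u i)) *
        (dm - Dn s u - dm * ∑ i, at' i s u)) with hH
    change ∑ s, P s * (dm - x ^ L * H s) = dm - x ^ L * ∑ s, P s * H s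
    have e : ∀ s, P s * (dm - x ^ L * H s) = P s * dm - x ^ L * (P s * H s) := by
      intro s; ring
    simp only [e, Finset.sum_sub_distrib]
    rw [← Finset.sum_mul, hP1, one_mul, ← Finset.mul_sum]
  have hX0 : 0 ≤ x ^ L := pow_nonneg hx0 _
  have hX1 : x ^ L ≤ 1 := pow_le_one₀ hx0 hx1
  have hEd0 : 0 ≤ ∑ ω, μ.p ω * F ω.1 ω.2 :=
    Finset.sum_nonneg fun ω _ => mul_nonneg (μ.nonneg ω) (hF0 _ _)
  have hρ0 : 0 ≤ dm * ∑ i, ρ i := by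
    apply mul_nonneg hdm
    refine Finset.sum_nonneg fun i _ => le_trans ?_ (hρ i)
    refine Finset.sum_nonneg fun ω _ => mul_nonneg (Finset.prod_nonneg fun t _ => μ.nonneg _) ?_
    split_ifs <;> norm_num
  have hfin := mul_le_mul_of_nonneg_left hlow hX0
  refine hup.trans ?_
  nlinarith [mul_le_mul_of_nonneg_right hX1 hEd0, mul_le_mul_of_nonneg_right hX1 hρ0]

end Block

end Cascade
namespace Cascade

/-- **Corollary 1 (achievability of the successive Wyner-Ziv Routing scheme).**
Given auxiliaries `(U_1,…,U_L)` jointly distributed with the sources according to a pmf of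
the form `p(s_1,…,s_L) ∏_l p(u_l | s_l)`, and a reconstruction function `g` with
`E[d(φ(S), g(U))] ≤ D`, any rate tuple with
`R_l ≥ Σ_{i ≤ l} I(S_i; U_i | U_1,…,U_{i-1})` achieves distortion `D`. -/
theorem wyner_ziv_routing_achievability
    {L : ℕ} {S U : Fin L → Type}
    [∀ l, Fintype (S l)] [∀ l, DecidableEq (S l)]
    [∀ l, Fintype (U l)] [∀ l, DecidableEq (U l)]
    {Zt Zhat : Type} [Fintype Zt] [Fintype Zhat]
    (φ : (∀ l, S l) → Zt) (d : Zt → Zhat → ℝ) (hd : ∀ z zh, 0 ≤ d z zh)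
    (pS : (∀ l, S l) → ℝ) (hpS0 : ∀ s, 0 ≤ pS s) (hpS1 : ∑ s, pS s = 1)
    (μ : FinPMF ((∀ l, S l) × (∀ l, U l)))
    (q : (l : Fin L) → S l → U l → ℝ)
    (hq0 : ∀ l s u, 0 ≤ q l s u)
    (hq1 : ∀ l s, ∑ u, q l s u = 1)
    (hfact : ∀ s u, μ.p (s, u) = pS s * ∏ l, q l (s l) (u l))
    (g : (∀ l, U l) → Zhat)
    (D : ℝ) (hdist : expect μ (fun ω => d (φ ω.1) (g ω.2)) ≤ D)
    (R : Fin L → ℝ)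
    (hR : ∀ l : Fin L,
      (∑ i ∈ Finset.univ.filter (fun i : Fin L => i ≤ l),
        condMI μ (fun ω => ω.1 i) (fun ω => ω.2 i)
          (fun ω => fun j => if j < i then some (ω.2 j) else none)) ≤ R l) :
    AchievesDistortion pS hpS0 hpS1 φ d R D := by
  classical
  intro ε hε
  -- nonemptiness
  have hSne : Nonempty (∀ l, S l) := by
    by_contra h
    rw [not_nonempty_iff] at h
    simp at hpS1
  obtain ⟨s0⟩ := hSne
  have hUne : ∀ l, Nonempty (U l) := by
    intro l
    by_contra h
    rw [not_nonempty_iff] at h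
    have := hq1 l (s0 l)
    simp at this
  let u0 : ∀ l, U l := fun l => (hUne l).some
  set I : Fin L → ℝ := fun i => condMI μ (fun ω => ω.1 i) (fun ω => ω.2 i)
          (fun ω => fun j => if j < i then some (ω.2 j) else none) with hI
  have hIeq := fun i => info_eq pS μ q hq0 hq1 hfact s0 i
  have hI0 : ∀ i, 0 ≤ I i := by
    intro i
    rw [hI]
    simp only
    rw [← hIeq i]
    exact info_nonneg pS μ q hpS0 hpS1 hq0 hq1 hfact s0 u0 i
  obtain ⟨δ, hδ, hδL⟩ : ∃ δ : ℝ, 0 < δ ∧ L * δ ≤ ε / 2 := by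
    refine ⟨ε / (2 * (L + 1)), by positivity, ?_⟩
    rw [mul_div_assoc', div_le_div_iff₀ (by positivity) (by positivity)]
    nlinarith
  choose ρ hρ0 hρ1 hρ using fun i => aep μ.p μ.nonneg μ.sum_one
    (fun ω => q i (ω.1 i) (ω.2 i)) (fun ω => rk μ q s0 i ω.2 (ω.2 i))
    (fun ω h => q_pos pS μ q hq0 hfact i ω h) (fun ω h => rk_pos μ q s0 i ω h)
    (I i) δ hδ (hIeq i)
  -- maximal distortion
  obtain ⟨dm, hdm0, hdm⟩ : ∃ dm : ℝ, 0 ≤ dm ∧ ∀ z zh, d z zh ≤ dm := by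
    refine ⟨∑ x : Zt × Zhat, d x.1 x.2, Finset.sum_nonneg fun x _ => hd _ _, ?_⟩
    intro z zh
    exact Finset.single_le_sum (f := fun x : Zt × Zhat => d x.1 x.2) (fun x _ => hd _ _)
      (Finset.mem_univ (z, zh))
  -- limits
  have hlim1 : Filter.Tendsto (fun n : ℕ => dm * ((1 - (1 - Real.exp (-(n : ℝ))) ^ L) +
      ∑ i, ρ i ^ n)) Filter.atTop (nhds 0) := by
    have h1 : Filter.Tendsto (fun n : ℕ => Real.exp (-(n : ℝ))) Filter.atTop (nhds 0) :=
      Real.tendsto_exp_neg_atTop_nhds_zero.comp tendsto_natCast_atTop_atTop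
    have h2 : Filter.Tendsto (fun n : ℕ => ∑ i, ρ i ^ n) Filter.atTop (nhds (∑ _i : Fin L, 0)) :=
      tendsto_finsetSum _ fun i _ => tendsto_pow_atTop_nhds_zero_of_lt_one (hρ0 i) (hρ1 i)
    have h3 := (((((h1.const_sub 1).pow L).const_sub 1).add h2).const_mul dm)
    simpa using h3
  have hlim2 : Filter.Tendsto (fun n : ℕ => (L : ℝ) * (Real.logb 2 ((n : ℝ) + 2) / n))
      Filter.atTop (nhds 0) := by
    have h1 := (Real.tendsto_pow_log_div_mul_add_atTop 1 (-2) 1 one_ne_zero).comp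
      (Filter.tendsto_atTop_add_const_right Filter.atTop (2 : ℝ)
        (tendsto_natCast_atTop_atTop (R := ℝ)))
    have h2 := (h1.div_const (Real.log 2)).const_mul (L : ℝ)
    simp only [zero_div, mul_zero] at h2
    refine h2.congr fun n => ?_
    simp only [Function.comp_apply, pow_one, one_mul, Real.logb]
    rw [show ((n : ℝ) + 2 + -2) = n by ring]
    ring
  obtain ⟨n, hn0, hn1, hn2⟩ := ((Filter.eventually_gt_atTop 0).and
    ((hlim1.eventually_lt_const hε).and
      (hlim2.eventually_lt_const (half_pos hε)))).exists
  have hnR : (0 : ℝ) < n := by exact_mod_cast hn0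
  let T : Fin L → ℝ := fun i => (2 : ℝ) ^ ((n : ℝ) * (I i + δ))
  have hT : ∀ i, 1 ≤ T i := fun i =>
    Real.one_le_rpow (by norm_num) (mul_nonneg hnR.le (by have := hI0 i; linarith))
  let K : Fin L → ℕ := fun i => ⌈n * T i⌉₊
  have hK : ∀ i, n * T i ≤ K i := fun i => Nat.le_ceil _
  let b0 : ∀ j, Fin n → U j := fun j _ => u0 j
  have hbb := block_bound (n := n) hn0 pS hpS0 hpS1 μ q hq0 hq1 hfact (rk μ q s0)
    (rk_nonneg μ q hq0 s0) (rk_sum μ q hq1 s0) (rk_local μ q s0) T hT K hK (fun i => ρ i ^ n)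
    (fun i => hρ i n) (fun s u => d (φ s) (g u)) (fun s u => hd _ _) dm (fun s u => hdm _ _)
    hdm0 b0
  obtain ⟨f, hfN, hf⟩ := derand (A := fun l => Fin n → S l) (B := fun l => Fin n → U l)
    (fun s => ∏ t, pS (fun l => s l t)) b0
    (fun i (a : Fin n → S i) (v : ∀ j, Fin n → U j) (b : Fin n → U i) =>
        lam (fun b : Fin n → U i => ∏ t, rk μ q s0 i (fun j => v j t) (b t))
        (fun b => ∏ t, q i (a t) (b t)) (T i) (b0 i) (K i) b)
    (fun i => K i + 1) (fun i => Nat.succ_pos _)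
    (fun i v W => oneShot (fun b : Fin n → U i => ∏ t, rk μ q s0 i (fun j => v j t) (b t))
      (fun (a : Fin n → S i) b => ∏ t, q i (a t) (b t))
      (fun b => Finset.prod_nonneg fun t _ => rk_nonneg μ q hq0 s0 _ _ _)
      (by
        rw [sum_prod_pi (fun t b => rk μ q s0 i (fun j => v j t) b)]
        simp [rk_sum μ q hq1])
      (fun a b => Finset.prod_nonneg fun t _ => hq0 _ _ _) (T i) (hT i) (b0 i) (K i) W)
    L (fun s u => (n : ℝ)⁻¹ * ∑ t, d (φ (fun l => s l t)) (g (fun l => u l t)))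
  have : Nonempty (∀ l, Fin n → S l) := ⟨fun l _ => s0 l⟩
  obtain ⟨c, hcM, hcR⟩ := exists_code g f b0 (fun i => K i + 1) hfN
  refine ⟨n, hn0, c, ?_, ?_⟩
  · intro l
    have hNi : ∀ i, Real.logb 2 ((K i + 1 : ℕ) : ℝ) ≤
        Real.logb 2 ((n : ℝ) + 2) + n * (I i + δ) := by
      intro i
      have hTp : 0 < T i := by have := hT i; linarith
      have h1 : ((K i + 1 : ℕ) : ℝ) ≤ ((n : ℝ) + 2) * T i := by
        have := (Nat.ceil_lt_add_one (show 0 ≤ n * T i by positivity)).le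
        push_cast
        have h2 := hT i
        change (K i : ℝ) ≤ _ at this
        nlinarith
      have h2 : Real.logb 2 (T i) = n * (I i + δ) := Real.logb_rpow (by norm_num) (by norm_num)
      rw [← h2, ← Real.logb_mul (by positivity) hTp.ne']
      exact Real.logb_le_logb_of_le (by norm_num) (by positivity) h1
    have h1 : Real.logb 2 (c.M l) ≤
        ∑ i ∈ Finset.univ.filter (fun i : Fin L => i ≤ l), Real.logb 2 ((K i + 1 : ℕ) : ℝ) := by
      rw [← Real.logb_prod _ _ (fun i _ => by positivity)]
      apply Real.logb_le_logb_of_le (by norm_num)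
      · exact_mod_cast c.M_pos l
      · exact_mod_cast hcM l
    have h2 : ∑ i ∈ Finset.univ.filter (fun i : Fin L => i ≤ l), Real.logb 2 ((K i + 1 : ℕ) : ℝ) ≤
        ∑ i ∈ Finset.univ.filter (fun i : Fin L => i ≤ l),
          (n * I i + (Real.logb 2 ((n : ℝ) + 2) + n * δ)) :=
      Finset.sum_le_sum fun i _ => by have := hNi i; linarith
    rw [Finset.sum_add_distrib, ← Finset.mul_sum, Finset.sum_const, nsmul_eq_mul] at h2
    have hlog : 0 ≤ Real.logb 2 ((n : ℝ) + 2) :=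
      Real.logb_nonneg (by norm_num) (by linarith)
    have h3 : ((Finset.univ.filter (fun i : Fin L => i ≤ l)).card : ℝ) ≤ L := by
      have := Finset.card_filter_le (Finset.univ : Finset (Fin L)) (fun i => i ≤ l)
      rw [Finset.card_univ, Fintype.card_fin] at this
      exact_mod_cast this
    have h4 := mul_le_mul_of_nonneg_right h3
      (show 0 ≤ Real.logb 2 ((n : ℝ) + 2) + n * δ by positivity)
    rw [div_le_iff₀ hnR]
    have h5 := mul_le_mul_of_nonneg_left (hR l) hnR.le
    have h6 : (L : ℝ) * Real.logb 2 ((n : ℝ) + 2) ≤ ε / 2 * n := by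
      rw [mul_div_assoc', div_lt_iff₀ hnR] at hn2
      exact hn2.le
    have h7 := mul_le_mul_of_nonneg_right hδL hnR.le
    change (n : ℝ) * ∑ i ∈ Finset.univ.filter (fun i : Fin L => i ≤ l), I i ≤ _ at h5
    nlinarith
  · have e : expect (iidPMF n pS hpS0 hpS1) (avgDistortion φ d c) =
        ∑ s : ∀ l, Fin n → S l, (∏ t, pS (fun l => s l t)) *
          ((n : ℝ)⁻¹ * ∑ t, d (φ (fun l => s l t)) (g (fun l => stt f b0 s L l t))) := by
      rw [swap_sum_one]
      unfold expect avgDistortion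
      simp only [hcR]
      rfl
    rw [e]
    refine hf.trans (hbb.trans ?_)
    have : ∑ ω : (∀ l, S l) × (∀ l, U l), μ.p ω * d (φ ω.1) (g ω.2) ≤ D := hdist
    linarith

end Cascade
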